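/- Let M = (ℤ, <, P₁, …, Pₙ) be a labelled linear ordering over ℤ. If M is not recurrent, then every element c ∈ ℤ is MSO-definable in M. If M is recurrent, then no element of ℤ is MSO-definable in M. -/

import Mathlib

namespace Paper

/-! ## Syntax and semantics of monadic second-order logic over labelled linear orders

A labelled linear ordering `M = (A, <, P₁, …, Pₙ)` is represented by a type `A`,
a binary relation `r : A → A → Prop` (the order) and `P : Fin n → Set A`
(the unary predicates). -/

/-- MSO formulas over the signature `{<, P₀, …, P_{n-1}}`.  First-order
variables and second-order (set) variables are both indexed by `ℕ`. -/
inductive MSO (n : ℕ) : Type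
  | lt (i j : ℕ) : MSO n
  | pred (k : Fin n) (i : ℕ) : MSO n
  | mem (i j : ℕ) : MSO n
  | not (φ : MSO n) : MSO n
  | and (φ ψ : MSO n) : MSO n
  | ex1 (i : ℕ) (φ : MSO n) : MSO n
  | ex2 (j : ℕ) (φ : MSO n) : MSO n

namespace MSO

variable {n : ℕ}

/-- Satisfaction of an MSO formula in the structure `(A, r, P)` under the
first-order assignment `v` and the second-order assignment `V`. -/
def Sat {A : Type} (r : A → A → Prop) (P : Fin n → Set A)
    (v : ℕ → A) (V : ℕ → Set A) : MSO n → Prop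
  | lt i j => r (v i) (v j)
  | pred k i => v i ∈ P k
  | mem i j => v i ∈ V j
  | not φ => ¬ Sat r P v V φ
  | and φ ψ => Sat r P v V φ ∧ Sat r P v V ψ
  | ex1 i φ => ∃ a : A, Sat r P (Function.update v i a) V φ
  | ex2 j φ => ∃ S : Set A, Sat r P v (Function.update V j S) φ

/-- Quantifier depth of an MSO formula. -/
def qd : MSO n → ℕ
  | lt _ _ => 0
  | pred _ _ => 0
  | mem _ _ => 0
  | not φ => qd φ
  | and φ ψ => max (qd φ) (qd ψ)
  | ex1 _ φ => qd φ + 1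
  | ex2 _ φ => qd φ + 1

/-- Free first-order variables of an MSO formula. -/
def fv1 : MSO n → Finset ℕ
  | lt i j => {i, j}
  | pred _ i => {i}
  | mem i _ => {i}
  | not φ => fv1 φ
  | and φ ψ => fv1 φ ∪ fv1 ψ
  | ex1 i φ => fv1 φ \ {i}
  | ex2 _ φ => fv1 φ

/-- Free second-order variables of an MSO formula. -/
def fv2 : MSO n → Finset ℕ
  | lt _ _ => ∅
  | pred _ _ => ∅
  | mem _ j => {j}
  | not φ => fv2 φ
  | and φ ψ => fv2 φ ∪ fv2 ψ
  | ex1 _ φ => fv2 φ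
  | ex2 j φ => fv2 φ \ {j}

/-- A sentence is a formula with no free variables. -/
def IsSentence (φ : MSO n) : Prop := fv1 φ = ∅ ∧ fv2 φ = ∅

/-- A sentence `φ` is true in the structure `(A, r, P)`. -/
def TrueIn {A : Type} (r : A → A → Prop) (P : Fin n → Set A) (φ : MSO n) : Prop :=
  ∀ (v : ℕ → A) (V : ℕ → Set A), Sat r P v V φ

/-- `Q ⊆ A` is MSO-definable in `(A, r, P)`: there is a formula `φ(x)` whose only
free variable is the first-order variable `0` defining `Q`. -/
def Definable {A : Type} (r : A → A → Prop) (P : Fin n → Set A) (Q : Set A) : Prop :=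
  ∃ φ : MSO n, fv1 φ ⊆ {0} ∧ fv2 φ = ∅ ∧
    ∀ a : A, a ∈ Q ↔ ∀ (v : ℕ → A) (V : ℕ → Set A), Sat r P (Function.update v 0 a) V φ

/-- A Gödel numbering of MSO formulas. -/
def encode : MSO n → ℕ
  | lt i j => Nat.pair 0 (Nat.pair i j)
  | pred k i => Nat.pair 1 (Nat.pair k i)
  | mem i j => Nat.pair 2 (Nat.pair i j)
  | not φ => Nat.pair 3 (encode φ)
  | and φ ψ => Nat.pair 4 (Nat.pair (encode φ) (encode ψ))
  | ex1 i φ => Nat.pair 5 (Nat.pair i (encode φ))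
  | ex2 j φ => Nat.pair 6 (Nat.pair j (encode φ))

/-- The MSO theory of the structure `(A, r, P)`, as a set of Gödel codes of the true
sentences. -/
def TheoryCodes {A : Type} (r : A → A → Prop) (P : Fin n → Set A) : Set ℕ :=
  {c | ∃ φ : MSO n, IsSentence φ ∧ encode φ = c ∧ TrueIn r P φ}

/-- Two structures have the same `k`-type: they satisfy the same MSO sentences of
quantifier depth `≤ k`. -/
def EquivType (k : ℕ) {A B : Type} (r : A → A → Prop) (P : Fin n → Set A)
    (s : B → B → Prop) (Q : Fin n → Set B) : Prop :=
  ∀ φ : MSO n, IsSentence φ → qd φ ≤ k → (TrueIn r P φ ↔ TrueIn s Q φ)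

/-- The `k`-type of a structure, as the set of Gödel codes of the true sentences
of quantifier depth `≤ k`. -/
def TypeSet (k : ℕ) {A : Type} (r : A → A → Prop) (P : Fin n → Set A) : Set ℕ :=
  {c | ∃ φ : MSO n, IsSentence φ ∧ qd φ ≤ k ∧ encode φ = c ∧ TrueIn r P φ}

end MSO

/-- The order relation of the substructure with domain `S`. -/
def subRel {A : Type} (r : A → A → Prop) (S : Set A) : S → S → Prop :=
  fun x y => r x y

/-- The predicates of the substructure with domain `S`. -/
def subPred {A : Type} {n : ℕ} (P : Fin n → Set A) (S : Set A) : Fin n → Set S :=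
  fun k => {x : S | (x : A) ∈ P k}

/-! ## Relative computability -/

/-- Partial recursiveness relative to an oracle `O` (Kleene-style, following
the definition of `Nat.Partrec`, with an extra base case for the oracle). -/
inductive RecursiveIn (O : ℕ →. ℕ) : (ℕ →. ℕ) → Prop
  | zero : RecursiveIn O (pure 0)
  | succ : RecursiveIn O ↑Nat.succ
  | left : RecursiveIn O ↑fun n : ℕ => n.unpair.1
  | right : RecursiveIn O ↑fun n : ℕ => n.unpair.2
  | oracle : RecursiveIn O O
  | pair {f g} : RecursiveIn O f → RecursiveIn O g →
      RecursiveIn O fun n => Nat.pair <$> f n <*> g n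
  | comp {f g} : RecursiveIn O f → RecursiveIn O g →
      RecursiveIn O fun n => g n >>= f
  | prec {f g} : RecursiveIn O f → RecursiveIn O g →
      RecursiveIn O (Nat.unpaired fun a m =>
        m.rec (f a) fun y IH => do let i ← IH; g (Nat.pair a (Nat.pair y i)))
  | rfind {f} : RecursiveIn O f →
      RecursiveIn O fun a => Nat.rfind fun m => (fun x => x = 0) <$> f (Nat.pair a m)

/-- The characteristic (partial) function of a set of naturals. -/
noncomputable def chi (S : Set ℕ) : ℕ →. ℕ :=
  fun m => Part.some (S.indicator (fun _ => 1) m)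

/-- `S` is recursive in (Turing reducible to) `T`. -/
def TuringRed (S T : Set ℕ) : Prop := RecursiveIn (chi T) (chi S)

/-- The (recursive) join of a finite family of sets of naturals. -/
def finJoin {m : ℕ} (P : Fin m → Set ℕ) : Set ℕ :=
  {c | ∃ i : Fin m, ∃ x : ℕ, c = Nat.pair i x ∧ x ∈ P i}

/-- The (recursive) join of two sets of naturals. -/
def setJoin (S T : Set ℕ) : Set ℕ :=
  {c | (∃ a, c = 2 * a ∧ a ∈ S) ∨ (∃ a, c = 2 * a + 1 ∧ a ∈ T)}

/-- A set of naturals is decidable (computable). -/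
def DecidableSet (S : Set ℕ) : Prop := ComputablePred (· ∈ S)

/-! ## Homogeneous sets for labelled orderings of the naturals -/

/-- `H = {h 0 < h 1 < ⋯}` is `k`-homogeneous for `(ℕ, <, P)`:
all substructures `M_{[h i, h j)}`, `i < j`, have the same `k`-type. -/
def KHomogeneous {n : ℕ} (P : Fin n → Set ℕ) (h : ℕ → ℕ) (k : ℕ) : Prop :=
  ∀ i j i' j' : ℕ, i < j → i' < j' →
    MSO.EquivType k
      (subRel (· < ·) (Set.Ico (h i) (h j))) (subPred P (Set.Ico (h i) (h j)))
      (subRel (· < ·) (Set.Ico (h i') (h j'))) (subPred P (Set.Ico (h i') (h j')))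

/-- `H = {h 0 < h 1 < ⋯}` is uniformly homogeneous for `(ℕ, <, P)`:
for each `k`, the set `{h k < h (k+1) < ⋯}` is `k`-homogeneous. -/
def UniformlyHomogeneous {n : ℕ} (P : Fin n → Set ℕ) (h : ℕ → ℕ) : Prop :=
  StrictMono h ∧
  ∀ k : ℕ, KHomogeneous P (fun i => h (k + i)) k

/-! ## ℤ-words -/

/-- The finite word `u` occurs at position `i` in the `ℤ`-word `w`. -/
def OccursAt {σ : Type} (w : ℤ → σ) (u : List σ) (i : ℤ) : Prop :=
  ∀ k : Fin u.length, w (i + (k : ℕ)) = u.get k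

/-- The finite word `u` occurs in the `ℤ`-word `w`. -/
def OccursIn {σ : Type} (w : ℤ → σ) (u : List σ) : Prop :=
  ∃ i : ℤ, OccursAt w u i

/-- `u` occurs in every prefix of `w`. -/
def InEveryPrefix {σ : Type} (w : ℤ → σ) (u : List σ) : Prop :=
  ∀ n : ℤ, ∃ i : ℤ, i + u.length ≤ n ∧ OccursAt w u i

/-- `u` occurs in every suffix of `w`. -/
def InEverySuffix {σ : Type} (w : ℤ → σ) (u : List σ) : Prop :=
  ∀ n : ℤ, ∃ i : ℤ, n ≤ i ∧ OccursAt w u i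

/-- A `ℤ`-word `w` is recurrent: for every regular language `X`, either no element
of `X` occurs in `w`, or every prefix and every suffix of `w` contains an
occurrence of some element of `X`. -/
def Recurrent {σ : Type} (w : ℤ → σ) : Prop :=
  ∀ X : Language σ, X.IsRegular →
    (∀ u ∈ X, ¬ OccursIn w u) ∨
    (∀ n : ℤ, (∃ u ∈ X, ∃ i : ℤ, i + u.length ≤ n ∧ OccursAt w u i) ∧
              (∃ u ∈ X, ∃ i : ℤ, n ≤ i ∧ OccursAt w u i))

/-- The `ℤ`-word `w(M)` over the alphabet `{0,1}ⁿ` associated with the labelled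
linear ordering `M = (ℤ, <, P₁, …, Pₙ)`. -/
def wordOf {n : ℕ} (P : Fin n → Set ℤ) : ℤ → (Fin n → Prop) :=
  fun i k => i ∈ P k

/-! ## Types of labelled sets

`MType k σ` is the type of `k`-types of labelled linear orders over the alphabet `σ`.  A set
quantifier is modelled by extending the alphabet with one more truth value per position. -/

/-- The `k`-types over the alphabet `σ`.  A `0`-type records which letters occur and which pairs of
letters occur in increasing order; a `(k + 1)`-type is the set of `k`-types of expansions by one
set. -/
def MType : ℕ → Type → Type
  | 0, σ => Set σ × Set (σ × σ)
  | k + 1, σ => Set (MType k (σ × Prop))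

namespace MType

theorem finite : ∀ (k : ℕ) (σ : Type) [Finite σ], Finite (MType k σ)
  | 0, σ, _ => inferInstanceAs (Finite (Set σ × Set (σ × σ)))
  | k + 1, σ, _ =>
    have := finite k (σ × Prop)
    inferInstanceAs (Finite (Set (MType k (σ × Prop))))

instance (k : ℕ) (σ : Type) [Finite σ] : Finite (MType k σ) := finite k σ

/-- The letters recorded by a `0`-type. -/
def letters {σ : Type} (t : MType 0 σ) : Set σ := Prod.fst t

/-- The increasing pairs of letters recorded by a `0`-type. -/
def pairs {σ : Type} (t : MType 0 σ) : Set (σ × σ) := Prod.snd t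

/-- The types of expansions recorded by a `(k + 1)`-type. -/
def expansions {k : ℕ} {σ : Type} (t : MType (k + 1) σ) : Set (MType k (σ × Prop)) := t

theorem ext_zero {σ : Type} {a b : MType 0 σ} (h : letters a = letters b)
    (h' : pairs a = pairs b) : a = b := Prod.ext h h'

theorem ext_succ {k : ℕ} {σ : Type} {a b : MType (k + 1) σ}
    (h : ∀ x, x ∈ expansions a ↔ x ∈ expansions b) : a = b := Set.ext h

/-- The type of a concatenation of two labelled orders. -/
def mul : ∀ {k : ℕ} {σ : Type}, MType k σ → MType k σ → MType k σ
  | 0, _, a, b => (letters a ∪ letters b, pairs a ∪ pairs b ∪ letters a ×ˢ letters b)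
  | _ + 1, _, a, b => Set.image2 mul (expansions a) (expansions b)

/-- The type of the empty labelled order. -/
def one : ∀ {k : ℕ} {σ : Type}, MType k σ
  | 0, _ => (∅, ∅)
  | k + 1, σ => ({one} : Set (MType k (σ × Prop)))

instance (k : ℕ) (σ : Type) : Mul (MType k σ) := ⟨mul⟩

instance (k : ℕ) (σ : Type) : One (MType k σ) := ⟨one⟩

theorem letters_mul {σ : Type} (a b : MType 0 σ) : letters (a * b) = letters a ∪ letters b := rfl

theorem pairs_mul {σ : Type} (a b : MType 0 σ) :
    pairs (a * b) = pairs a ∪ pairs b ∪ letters a ×ˢ letters b := rfl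

theorem expansions_mul {k : ℕ} {σ : Type} (a b : MType (k + 1) σ) :
    expansions (a * b) = Set.image2 (fun x y => x * y) (expansions a) (expansions b) := rfl

theorem letters_one {σ : Type} : letters (1 : MType 0 σ) = ∅ := rfl

theorem pairs_one {σ : Type} : pairs (1 : MType 0 σ) = ∅ := rfl

theorem expansions_one {k : ℕ} {σ : Type} : expansions (1 : MType (k + 1) σ) = {1} := rfl

protected theorem mul_assoc : ∀ {k : ℕ} {σ : Type} (a b c : MType k σ), a * b * c = a * (b * c)
  | 0, _, a, b, c => by
    refine ext_zero (Set.union_assoc _ _ _) ?_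
    ext ⟨x, y⟩
    simp only [pairs_mul, letters_mul, Set.mem_union, Set.mem_prod]
    tauto
  | _ + 1, _, a, b, c => ext_succ fun x => by
    rw [expansions_mul, expansions_mul, Set.image2_assoc MType.mul_assoc]
    rfl

protected theorem one_mul : ∀ {k : ℕ} {σ : Type} (a : MType k σ), 1 * a = a
  | 0, _, a => ext_zero (by simp [letters_mul, letters_one])
      (by simp [pairs_mul, pairs_one, letters_one])
  | k + 1, σ, a => ext_succ fun x => by
    rw [expansions_mul, expansions_one, Set.image2_singleton_left]
    simp only [MType.one_mul, Set.image_id']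

protected theorem mul_one : ∀ {k : ℕ} {σ : Type} (a : MType k σ), a * 1 = a
  | 0, _, a => ext_zero (by simp [letters_mul, letters_one])
      (by simp [pairs_mul, pairs_one, letters_one])
  | k + 1, σ, a => ext_succ fun x => by
    rw [expansions_mul, expansions_one, Set.image2_singleton_right]
    simp only [MType.mul_one, Set.image_id']

instance (k : ℕ) (σ : Type) : Monoid (MType k σ) where
  mul_assoc := MType.mul_assoc
  one_mul := MType.one_mul
  mul_one := MType.mul_one

/-- The type of the concatenation of a sequence of labelled orders. -/
def omega : ∀ {k : ℕ} {σ : Type}, (ℕ → MType k σ) → MType k σ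
  | 0, _, t => (⋃ i, letters (t i),
      (⋃ i, pairs (t i)) ∪ {x | ∃ i j, i < j ∧ x.1 ∈ letters (t i) ∧ x.2 ∈ letters (t j)})
  | k + 1, σ, t => ({x | ∃ s : ℕ → MType k (σ × Prop), (∀ i, s i ∈ expansions (t i)) ∧
      omega s = x} : Set (MType k (σ × Prop)))

theorem mem_letters_omega {σ : Type} {t : ℕ → MType 0 σ} {x : σ} :
    x ∈ letters (omega t) ↔ ∃ i, x ∈ letters (t i) := Set.mem_iUnion

theorem mem_pairs_omega {σ : Type} {t : ℕ → MType 0 σ} {x : σ × σ} :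
    x ∈ pairs (omega t) ↔ (∃ i, x ∈ pairs (t i)) ∨
      ∃ i j, i < j ∧ x.1 ∈ letters (t i) ∧ x.2 ∈ letters (t j) :=
  or_congr Set.mem_iUnion Iff.rfl

theorem mem_expansions_omega {k : ℕ} {σ : Type} {t : ℕ → MType (k + 1) σ}
    {x : MType k (σ × Prop)} : x ∈ expansions (omega t) ↔
      ∃ s : ℕ → MType k (σ × Prop), (∀ i, s i ∈ expansions (t i)) ∧ omega s = x := Iff.rfl

/-- Regrouping the factors of `s₀ t₀ s₁ t₁ ⋯`. -/
theorem omega_mul : ∀ {k : ℕ} {σ : Type} (s t : ℕ → MType k σ),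
    omega (fun i => s i * t i) = s 0 * omega (fun i => t i * s (i + 1))
  | 0, σ, s, t => by
    refine ext_zero ?_ ?_
    · ext x
      simp only [mem_letters_omega, letters_mul, Set.mem_union]
      constructor
      · rintro ⟨i | i, h | h⟩
        · exact Or.inl h
        · exact Or.inr ⟨0, Or.inl h⟩
        · exact Or.inr ⟨i, Or.inr h⟩
        · exact Or.inr ⟨i + 1, Or.inl h⟩
      · rintro (h | ⟨i, h | h⟩)
        · exact ⟨0, Or.inl h⟩
        · exact ⟨i, Or.inr h⟩
        · exact ⟨i + 1, Or.inl h⟩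
    · ext ⟨x, y⟩
      simp only [mem_letters_omega, mem_pairs_omega, letters_mul, pairs_mul, Set.mem_union,
        Set.mem_prod]
      constructor
      · rintro (⟨i, (h | h) | ⟨h, h'⟩⟩ | ⟨i, j, hij, h, h'⟩)
        · rcases i with _ | i
          · exact Or.inl (Or.inl h)
          · exact Or.inl (Or.inr (Or.inl ⟨i, Or.inl (Or.inr h)⟩))
        · exact Or.inl (Or.inr (Or.inl ⟨i, Or.inl (Or.inl h)⟩))
        · rcases i with _ | i
          · exact Or.inr ⟨h, 0, Or.inl h'⟩
          · exact Or.inl (Or.inr (Or.inr ⟨i, i + 1, by omega, Or.inr h, Or.inl h'⟩))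
        · obtain ⟨j, rfl⟩ : ∃ j', j = j' + 1 := ⟨j - 1, by omega⟩
          rcases h with h | h
          · rcases i with _ | i
            · rcases h' with h' | h'
              · exact Or.inr ⟨h, j, Or.inr h'⟩
              · exact Or.inr ⟨h, j + 1, Or.inl h'⟩
            · rcases h' with h' | h'
              · exact Or.inl (Or.inr (Or.inr ⟨i, j, by omega, Or.inr h, Or.inr h'⟩))
              · exact Or.inl (Or.inr (Or.inr ⟨i, j + 1, by omega, Or.inr h, Or.inl h'⟩))
          · rcases h' with h' | h'
            · rcases (Nat.lt_succ_iff_lt_or_eq.1 hij) with hij | rfl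
              · exact Or.inl (Or.inr (Or.inr ⟨i, j, hij, Or.inl h, Or.inr h'⟩))
              · exact Or.inl (Or.inr (Or.inl ⟨i, Or.inr ⟨h, h'⟩⟩))
            · exact Or.inl (Or.inr (Or.inr ⟨i, j + 1, hij, Or.inl h, Or.inl h'⟩))
      · rintro ((h | (⟨i, (h | h) | ⟨h, h'⟩⟩ | ⟨i, j, hij, h, h'⟩)) | ⟨h, j, h' | h'⟩)
        · exact Or.inl ⟨0, Or.inl (Or.inl h)⟩
        · exact Or.inl ⟨i, Or.inl (Or.inr h)⟩
        · exact Or.inl ⟨i + 1, Or.inl (Or.inl h)⟩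
        · exact Or.inr ⟨i, i + 1, by omega, Or.inr h, Or.inl h'⟩
        · rcases h with h | h <;> rcases h' with h' | h'
          · exact Or.inr ⟨i, j, hij, Or.inr h, Or.inr h'⟩
          · exact Or.inr ⟨i, j + 1, by omega, Or.inr h, Or.inl h'⟩
          · rcases Nat.lt_or_eq_of_le (Nat.succ_le_of_lt hij) with hij | rfl
            · exact Or.inr ⟨i + 1, j, hij, Or.inl h, Or.inr h'⟩
            · exact Or.inl ⟨i + 1, Or.inr ⟨h, h'⟩⟩
          · exact Or.inr ⟨i + 1, j + 1, by omega, Or.inl h, Or.inl h'⟩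
        · rcases j with _ | j
          · exact Or.inl ⟨0, Or.inr ⟨h, h'⟩⟩
          · exact Or.inr ⟨0, j + 1, by omega, Or.inl h, Or.inr h'⟩
        · exact Or.inr ⟨0, j + 1, by omega, Or.inl h, Or.inl h'⟩
  | k + 1, σ, s, t => by
    refine ext_succ fun x => ?_
    simp only [mem_expansions_omega, expansions_mul]
    constructor
    · rintro ⟨r, hr, rfl⟩
      choose a ha b hb hab using hr
      obtain rfl : (fun i => a i * b i) = r := funext hab
      exact ⟨a 0, ha 0, _, mem_expansions_omega.2 ⟨_, fun i => ⟨b i, hb i, a (i + 1), ha (i + 1), rfl⟩, rfl⟩,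
        (omega_mul a b).symm⟩
    · rintro ⟨a₀, ha₀, _, ⟨r, hr, rfl⟩, rfl⟩
      choose b hb a ha hab using hr
      obtain rfl : (fun i => b i * a i) = r := funext hab
      refine ⟨fun i => Nat.casesOn i a₀ a * b i, fun i => ⟨_, ?_, b i, hb i, rfl⟩,
        omega_mul (fun i => Nat.casesOn i a₀ a) b⟩
      rcases i with _ | i
      exacts [ha₀, ha i]

theorem omega_const_mul {k : ℕ} {σ : Type} (s t : MType k σ) :
    omega (fun _ => s * t) = s * omega (fun _ => t * s) :=
  omega_mul (fun _ => s) (fun _ => t)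

/-- The type of the reversed labelled order. -/
def rev : ∀ {k : ℕ} {σ : Type}, MType k σ → MType k σ
  | 0, _, a => (letters a, Prod.swap ⁻¹' pairs a)
  | _ + 1, _, a => rev '' expansions a

/-- The type of a single position labelled by a given letter. -/
def letter : ∀ (k : ℕ) {σ : Type}, σ → MType k σ
  | 0, _, x => ({x}, ∅)
  | k + 1, _, x => Set.range fun p : Prop => letter k (x, p)

/-- The type of a finite word. -/
def ofList (k : ℕ) {σ : Type} (u : List σ) : MType k σ := (u.map (letter k)).prod

theorem ofList_append (k : ℕ) {σ : Type} (u v : List σ) :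
    ofList k (u ++ v) = ofList k u * ofList k v := by
  simp [ofList]

end MType

open MType

/-! ## Types of the restrictions of a word to subsets of its domain -/

/-- The `k`-type of the restriction of the labelling `w` to the set `D`. -/
def tp {Z : Type} [LinearOrder Z] : ∀ (k : ℕ) {σ : Type}, (Z → σ) → Set Z → MType k σ
  | 0, _, w, D => (w '' D, {q | ∃ x ∈ D, ∃ y ∈ D, x < y ∧ q = (w x, w y)})
  | k + 1, _, w, D => Set.range fun a : Z → Prop => tp k (fun x => (w x, a x)) D

section tp

variable {Z : Type} [LinearOrder Z]

theorem mem_letters_tp {σ : Type} {w : Z → σ} {D : Set Z} {p : σ} :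
    p ∈ letters (tp 0 w D) ↔ ∃ x ∈ D, w x = p := Iff.rfl

theorem mem_pairs_tp {σ : Type} {w : Z → σ} {D : Set Z} {q : σ × σ} :
    q ∈ pairs (tp 0 w D) ↔ ∃ x ∈ D, ∃ y ∈ D, x < y ∧ q = (w x, w y) := Iff.rfl

theorem mem_expansions_tp {k : ℕ} {σ : Type} {w : Z → σ} {D : Set Z} {t : MType k (σ × Prop)} :
    t ∈ expansions (tp (k + 1) w D) ↔ ∃ a : Z → Prop, tp k (fun x => (w x, a x)) D = t := Iff.rfl

theorem tp_congr : ∀ (k : ℕ) {σ : Type} {w w' : Z → σ} {D : Set Z},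
    (∀ x ∈ D, w x = w' x) → tp k w D = tp k w' D
  | 0, σ, w, w', D, h => by
    refine ext_zero (Set.image_congr h) ?_
    ext q
    refine exists_congr fun x => and_congr_right fun hx => exists_congr fun y =>
      and_congr_right fun hy => ?_
    rw [h x hx, h y hy]
  | k + 1, σ, w, w', D, h => by
    refine congrArg Set.range (funext fun a => tp_congr k fun x hx => ?_)
    rw [h x hx]

theorem tp_iUnion : ∀ (k : ℕ) {σ : Type} (w : Z → σ) (D : ℕ → Set Z),
    (∀ i j, i < j → ∀ x ∈ D i, ∀ y ∈ D j, x < y) →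
    tp k w (⋃ i, D i) = omega (fun i => tp k w (D i))
  | 0, σ, w, D, h => by
    refine ext_zero (Set.image_iUnion) ?_
    ext q
    simp only [mem_pairs_omega, mem_pairs_tp, mem_letters_tp, Set.mem_iUnion]
    constructor
    · rintro ⟨x, ⟨i, hx⟩, y, ⟨j, hy⟩, hxy, rfl⟩
      rcases lt_trichotomy i j with hij | rfl | hij
      · exact Or.inr ⟨i, j, hij, ⟨x, hx, rfl⟩, ⟨y, hy, rfl⟩⟩
      · exact Or.inl ⟨i, x, hx, y, hy, hxy, rfl⟩
      · exact absurd (h j i hij y hy x hx) hxy.not_gt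
    · rintro (⟨i, x, hx, y, hy, hxy, rfl⟩ | ⟨i, j, hij, ⟨x, hx, hx'⟩, ⟨y, hy, hy'⟩⟩)
      · exact ⟨x, ⟨i, hx⟩, y, ⟨i, hy⟩, hxy, rfl⟩
      · exact ⟨x, ⟨i, hx⟩, y, ⟨j, hy⟩, h i j hij x hx y hy, Prod.ext hx'.symm hy'.symm⟩
  | k + 1, σ, w, D, h => by
    refine ext_succ fun t => ?_
    constructor
    · rintro ⟨a, rfl⟩
      exact ⟨_, fun i => ⟨a, rfl⟩, (tp_iUnion k _ D h).symm⟩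
    · rintro ⟨s, hs, rfl⟩
      simp only [mem_expansions_tp] at hs
      choose a ha using hs
      refine ⟨fun x => ∃ i, x ∈ D i ∧ a i x, (tp_iUnion k _ D h).trans ?_⟩
      congr 1
      funext i
      rw [← ha i]
      refine tp_congr k fun x hx => Prod.ext rfl (propext ⟨?_, fun hax => ⟨i, hx, hax⟩⟩)
      rintro ⟨j, hj, haj⟩
      rcases lt_trichotomy i j with hij | rfl | hij
      · exact absurd (h i j hij x hx x hj) (lt_irrefl x)
      · exact haj
      · exact absurd (h j i hij x hj x hx) (lt_irrefl x)

theorem tp_union : ∀ (k : ℕ) {σ : Type} (w : Z → σ) (D E : Set Z),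
    (∀ x ∈ D, ∀ y ∈ E, x < y) → tp k w (D ∪ E) = tp k w D * tp k w E
  | 0, σ, w, D, E, h => by
    refine ext_zero (Set.image_union _ _ _) ?_
    ext q
    simp only [pairs_mul, mem_pairs_tp, mem_letters_tp, Set.mem_union, Set.mem_prod]
    constructor
    · rintro ⟨x, hx | hx, y, hy | hy, hxy, rfl⟩
      · exact Or.inl (Or.inl ⟨x, hx, y, hy, hxy, rfl⟩)
      · exact Or.inr ⟨⟨x, hx, rfl⟩, ⟨y, hy, rfl⟩⟩
      · exact absurd (h y hy x hx) hxy.not_gt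
      · exact Or.inl (Or.inr ⟨x, hx, y, hy, hxy, rfl⟩)
    · rintro ((⟨x, hx, y, hy, hxy, rfl⟩ | ⟨x, hx, y, hy, hxy, rfl⟩) |
        ⟨⟨x, hx, hx'⟩, ⟨y, hy, hy'⟩⟩)
      · exact ⟨x, Or.inl hx, y, Or.inl hy, hxy, rfl⟩
      · exact ⟨x, Or.inr hx, y, Or.inr hy, hxy, rfl⟩
      · exact ⟨x, Or.inl hx, y, Or.inr hy, h x hx y hy, Prod.ext hx'.symm hy'.symm⟩
  | k + 1, σ, w, D, E, h => by
    refine ext_succ fun t => ?_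
    constructor
    · rintro ⟨a, rfl⟩
      exact ⟨_, ⟨a, rfl⟩, _, ⟨a, rfl⟩, (tp_union k _ D E h).symm⟩
    · rintro ⟨_, ⟨a, rfl⟩, _, ⟨b, rfl⟩, rfl⟩
      refine ⟨fun x => x ∈ D ∧ a x ∨ x ∈ E ∧ b x, (tp_union k _ D E h).trans ?_⟩
      congr 1
      · refine tp_congr k fun x hx => Prod.ext rfl (propext ⟨?_, fun hax => Or.inl ⟨hx, hax⟩⟩)
        rintro (⟨-, hax⟩ | ⟨hx', -⟩)
        exacts [hax, absurd (h x hx x hx') (lt_irrefl x)]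
      · refine tp_congr k fun x hx => Prod.ext rfl (propext ⟨?_, fun hax => Or.inr ⟨hx, hax⟩⟩)
        rintro (⟨hx', -⟩ | ⟨-, hax⟩)
        exacts [absurd (h x hx' x hx) (lt_irrefl x), hax]

theorem tp_empty : ∀ (k : ℕ) {σ : Type} (w : Z → σ), tp k w ∅ = 1
  | 0, σ, w => ext_zero (Set.image_empty _) (Set.eq_empty_of_forall_notMem (by simp [mem_pairs_tp]))
  | k + 1, σ, w => by
    refine ext_succ fun t => ⟨?_, fun h => ⟨fun _ => True, (tp_empty k _).trans ?_⟩⟩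
    · rintro ⟨a, rfl⟩
      exact tp_empty k _
    · exact (Set.mem_singleton_iff.1 h).symm

theorem tp_singleton : ∀ (k : ℕ) {σ : Type} (w : Z → σ) (z : Z), tp k w {z} = letter k (w z)
  | 0, σ, w, z => ext_zero Set.image_singleton (Set.eq_empty_of_forall_notMem (by simp [mem_pairs_tp]))
  | k + 1, σ, w, z => by
    refine ext_succ fun t => ⟨?_, ?_⟩
    · rintro ⟨a, rfl⟩
      exact ⟨a z, (tp_singleton k (fun x => (w x, a x)) z).symm⟩
    · rintro ⟨p, rfl⟩
      exact ⟨fun _ => p, tp_singleton k (fun x => (w x, p)) z⟩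

/-- Reversing the order through an antitone involution reverses types. -/
theorem tp_rev (f : Z → Z) (hf : StrictAnti f) (hf' : Function.Involutive f) :
    ∀ (k : ℕ) {σ : Type} (w : Z → σ) (D : Set Z), tp k w D = rev (tp k (w ∘ f) (f ⁻¹' D))
  | 0, σ, w, D => by
    refine ext_zero ?_ ?_
    · ext t
      constructor
      · rintro ⟨x, hx, rfl⟩
        exact ⟨f x, by simpa [hf' x] using hx, by simp [hf' x]⟩
      · rintro ⟨x, hx, rfl⟩
        exact ⟨f x, hx, rfl⟩
    · ext ⟨s, t⟩
      constructor
      · rintro ⟨x, hx, y, hy, hxy, h⟩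
        exact ⟨f y, by simpa [hf' y] using hy, f x, by simpa [hf' x] using hx, hf hxy,
          by simpa [hf' x, hf' y, and_comm] using h⟩
      · rintro ⟨x, hx, y, hy, hxy, h⟩
        exact ⟨f y, hy, f x, hx, hf hxy, by simpa [and_comm] using h⟩
  | k + 1, σ, w, D => by
    refine ext_succ fun t => ?_
    constructor
    · rintro ⟨a, rfl⟩
      exact ⟨_, ⟨a ∘ f, rfl⟩, (tp_rev f hf hf' k (fun x => (w x, a x)) D).symm⟩
    · rintro ⟨_, ⟨a, rfl⟩, rfl⟩
      refine ⟨a ∘ f, (tp_rev f hf hf' k _ D).trans ?_⟩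
      congr 2
      funext x
      simp [hf' x]

/-- Labelled sets of the same type realise the same letters. -/
theorem tp_letter : ∀ {k : ℕ} {σ : Type} {w w' : Z → σ} {D D' : Set Z}, tp k w D = tp k w' D' →
    ∀ x ∈ D, ∃ y ∈ D', w' y = w x
  | 0, σ, w, w', D, D', h, x, hx => by
    have : w x ∈ Set.image w' D' := by
      rw [← show Set.image w D = Set.image w' D' from congrArg Prod.fst h]
      exact ⟨x, hx, rfl⟩
    exact this
  | k + 1, σ, w, w', D, D', h, x, hx => by
    obtain ⟨b, hb⟩ := (Set.ext_iff.1 h _).1 ⟨fun _ => True, rfl⟩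
    obtain ⟨y, hy, hxy⟩ := tp_letter hb.symm x hx
    exact ⟨y, hy, congrArg Prod.fst hxy⟩

/-- Labelled sets of the same type realise the same increasing pairs of letters. -/
theorem tp_pair : ∀ {k : ℕ} {σ : Type} {w w' : Z → σ} {D D' : Set Z}, tp k w D = tp k w' D' →
    ∀ x ∈ D, ∀ y ∈ D, x < y → ∃ x' ∈ D', ∃ y' ∈ D', x' < y' ∧ w' x' = w x ∧ w' y' = w y
  | 0, σ, w, w', D, D', h, x, hx, y, hy, hxy => by
    have : (w x, w y) ∈ {q | ∃ x ∈ D', ∃ y ∈ D', x < y ∧ q = (w' x, w' y)} := by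
      rw [← show {q | ∃ x ∈ D, ∃ y ∈ D, x < y ∧ q = (w x, w y)} =
        {q | ∃ x ∈ D', ∃ y ∈ D', x < y ∧ q = (w' x, w' y)} from congrArg Prod.snd h]
      exact ⟨x, hx, y, hy, hxy, rfl⟩
    obtain ⟨x', hx', y', hy', hxy', he⟩ := this
    exact ⟨x', hx', y', hy', hxy', (congrArg Prod.fst he).symm, (congrArg Prod.snd he).symm⟩
  | k + 1, σ, w, w', D, D', h, x, hx, y, hy, hxy => by
    obtain ⟨b, hb⟩ := (Set.ext_iff.1 h _).1 ⟨fun _ => True, rfl⟩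
    obtain ⟨x', hx', y', hy', hxy', h₁, h₂⟩ := tp_pair hb.symm x hx y hy hxy
    exact ⟨x', hx', y', hy', hxy', congrArg Prod.fst h₁, congrArg Prod.fst h₂⟩

/-- Every expansion of one of two labelled sets of the same type is matched by the other one. -/
theorem tp_succ_exists {k : ℕ} {σ : Type} {w w' : Z → σ} {D D' : Set Z}
    (h : tp (k + 1) w D = tp (k + 1) w' D') (a : Z → Prop) :
    ∃ b : Z → Prop, tp k (fun x => (w x, a x)) D = tp k (fun x => (w' x, b x)) D' := by
  obtain ⟨b, hb⟩ := (Set.ext_iff.1 h _).1 ⟨a, rfl⟩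
  exact ⟨b, hb.symm⟩

end tp

/-! ## Finite monoids -/

section FiniteMonoid

variable {S : Type} [Monoid S]

theorem eq_pow_mul_mul_pow {u p r : S} (h : u = p * u * r) (n : ℕ) : u = p ^ n * u * r ^ n := by
  induction n with
  | zero => simp
  | succ n ih =>
    calc u = p ^ n * (p * u * r) * r ^ n := by rw [← h, ← ih]
      _ = p ^ (n + 1) * u * r ^ (n + 1) := by rw [pow_succ, pow_succ']; simp only [mul_assoc]

variable [Finite S]

theorem exists_pow_idempotent (x : S) : ∃ n : ℕ, x ^ (n + 1) * x ^ (n + 1) = x ^ (n + 1) := by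
  obtain ⟨i, j, hij, h⟩ : ∃ i j, i < j ∧ x ^ i = x ^ j := by
    obtain ⟨i, j, hne, h⟩ := Finite.exists_ne_map_eq_of_infinite (fun n : ℕ => x ^ n)
    rcases lt_or_gt_of_ne hne with hlt | hlt
    exacts [⟨i, j, hlt, h⟩, ⟨j, i, hlt, h.symm⟩]
  obtain ⟨p, rfl⟩ : ∃ p, j = i + (p + 1) := ⟨j - i - 1, by omega⟩
  have hper : ∀ t, x ^ (i + t * (p + 1)) = x ^ i := by
    intro t
    induction t with
    | zero => simp
    | succ t ih =>
      rw [show i + (t + 1) * (p + 1) = (i + t * (p + 1)) + (p + 1) by ring, pow_add, ih,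
        ← pow_add, ← h]
  refine ⟨(i + 1) * (p + 1) - 1, ?_⟩
  have hpos : 0 < (i + 1) * (p + 1) := by positivity
  rw [Nat.sub_add_cancel hpos, ← pow_add]
  obtain ⟨r, hr⟩ : ∃ r, (i + 1) * (p + 1) = i + r := ⟨(i + 1) * (p + 1) - i, by
    have : i ≤ (i + 1) * (p + 1) := by nlinarith
    omega⟩
  calc x ^ ((i + 1) * (p + 1) + (i + 1) * (p + 1))
      = x ^ (i + (i + 1) * (p + 1)) * x ^ r := by rw [← pow_add]; congr 1; omega
    _ = x ^ ((i + 1) * (p + 1)) := by rw [hper, ← pow_add, hr]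

theorem exists_mul_pow_eq_of_eq_mul_mul {u p r : S} (h : u = p * u * r) :
    ∃ n : ℕ, u * r ^ (n + 1) = u := by
  obtain ⟨n, hn⟩ := exists_pow_idempotent r
  refine ⟨n, ?_⟩
  conv_lhs => rw [eq_pow_mul_mul_pow h (n + 1), mul_assoc, hn]
  exact (eq_pow_mul_mul_pow h (n + 1)).symm

theorem exists_pow_mul_eq_of_eq_mul_mul {u p r : S} (h : u = p * u * r) :
    ∃ n : ℕ, p ^ (n + 1) * u = u := by
  obtain ⟨n, hn⟩ := exists_pow_idempotent p
  refine ⟨n, ?_⟩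
  conv_lhs => rw [eq_pow_mul_mul_pow h (n + 1), ← mul_assoc, ← mul_assoc, hn]
  exact (eq_pow_mul_mul_pow h (n + 1)).symm

/-- If `u = u e` and `u s e` both divide the idempotent `e`, then `u s e = u g` for an element `g`
of the maximal subgroup at `e`. -/
theorem exists_group_element {e u s : S} (he : e * e = e) (hue : u * e = u)
    (h₁ : ∃ p q, e = p * u * q) (h₂ : ∃ p q, e = p * (u * s * e) * q) :
    ∃ g : S, u * s * e = u * g ∧ g * e = g ∧ ∃ n : ℕ, g ^ (n + 1) = e := by
  obtain ⟨g, hg⟩ : ∃ g, g = e * s * e := ⟨_, rfl⟩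
  have hge : g * e = g := by rw [hg, mul_assoc, he]
  have heg : e * g = g := by rw [hg, mul_assoc, ← mul_assoc, he, ← mul_assoc]
  have hug : u * s * e = u * g := by rw [hg, ← mul_assoc, ← mul_assoc, hue]
  obtain ⟨y, hy⟩ : ∃ y, u * g * y = u := by
    obtain ⟨p, q, h⟩ := h₂
    have : u = u * p * u * (g * q) := by
      conv_lhs => rw [← hue, h, hug]
      simp only [mul_assoc]
    obtain ⟨n, hn⟩ := exists_mul_pow_eq_of_eq_mul_mul this
    refine ⟨q * (g * q) ^ n, ?_⟩
    rw [pow_succ'] at hn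
    simpa only [mul_assoc] using hn
  obtain ⟨z, hz⟩ : ∃ z, z * u = e := by
    obtain ⟨p, q, h⟩ := h₁
    have : e = p * u * e * q := by
      rw [mul_assoc p, hue]
      exact h
    obtain ⟨n, hn⟩ := exists_pow_mul_eq_of_eq_mul_mul this
    refine ⟨(p * u) ^ n * p, ?_⟩
    rw [pow_succ, mul_assoc, mul_assoc p, hue] at hn
    rwa [mul_assoc]
  have hgy : g * (e * y * e) = e := by
    calc g * (e * y * e) = (e * g) * (e * y * e) := by rw [heg]
      _ = z * (u * (g * e) * y) * e := by rw [← hz]; simp only [mul_assoc]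
      _ = e := by rw [hge, hy, hz, he]
  have hpow : ∀ m : ℕ, g ^ (m + 1) * (e * y * e) ^ (m + 1) = e := by
    intro m
    induction m with
    | zero => simpa using hgy
    | succ m ih =>
      have hpe : g ^ (m + 1) * e = g ^ (m + 1) := by rw [pow_succ, mul_assoc, hge]
      calc g ^ (m + 1 + 1) * (e * y * e) ^ (m + 1 + 1)
          = g ^ (m + 1) * (g * (e * y * e)) * (e * y * e) ^ (m + 1) := by
            rw [pow_succ g (m + 1), pow_succ' (e * y * e) (m + 1)]; simp only [mul_assoc]
        _ = e := by rw [hgy, hpe, ih]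
  obtain ⟨n, hn⟩ := exists_pow_idempotent g
  refine ⟨g, hug, hge, n, ?_⟩
  calc g ^ (n + 1) = g ^ (n + 1) * e := by rw [pow_succ, mul_assoc, hge]
    _ = g ^ (n + 1) * g ^ (n + 1) * (e * y * e) ^ (n + 1) := by rw [mul_assoc, hpow n]
    _ = e := by rw [hn, hpow n]

end FiniteMonoid

/-- The infinite Ramsey theorem for pairs. -/
theorem exists_homogeneous {S : Type} [Finite S] (h : ℕ → ℕ → S) :
    ∃ (e : S) (f : ℕ → ℕ), ∀ m n, m < n → f m < f n ∧ h (f m) (f n) = e := by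
  have hlim : ∀ g : ℕ → S, ∃ s, ∀ᶠ j in (Filter.hyperfilter ℕ : Filter ℕ), g j = s := by
    intro g
    rw [← Ultrafilter.eventually_exists_iff]
    exact Filter.Eventually.of_forall fun j => ⟨g j, rfl⟩
  choose c hc using fun i => hlim (h i)
  obtain ⟨e, he⟩ := hlim c
  obtain ⟨f, -, hf⟩ := exists_seq_of_forall_finset_exists (fun i => c i = e)
    (fun i j => i < j ∧ h i j = e) (by
      intro s hs
      have hgt : ∀ i, ∀ᶠ j in (Filter.hyperfilter ℕ : Filter ℕ), i < j := fun i =>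
        Nat.hyperfilter_le_atTop (Filter.eventually_gt_atTop i)
      have hall : ∀ᶠ j in (Filter.hyperfilter ℕ : Filter ℕ), ∀ i ∈ s, i < j ∧ h i j = e := by
        rw [Filter.eventually_all_finset]
        intro i hi
        filter_upwards [hgt i, hc i] with j h₁ h₂
        exact ⟨h₁, h₂.trans (hs i hi)⟩
      exact (he.and hall).exists)
  exact ⟨e, f, hf⟩

/-! ## Recurrence in terms of types -/

section Recurrence

variable {σ : Type}

theorem tp_Ico_mul (k : ℕ) (w : ℤ → σ) {a b c : ℤ} (hab : a ≤ b) (hbc : b ≤ c) :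
    tp k w (Set.Ico a b) * tp k w (Set.Ico b c) = tp k w (Set.Ico a c) := by
  rw [← tp_union, Set.Ico_union_Ico_eq_Ico hab hbc]
  rintro x ⟨-, hx⟩ y ⟨hy, -⟩
  omega

theorem tp_Ico_mul_Ici (k : ℕ) (w : ℤ → σ) {a b : ℤ} (hab : a ≤ b) :
    tp k w (Set.Ico a b) * tp k w (Set.Ici b) = tp k w (Set.Ici a) := by
  rw [← tp_union, Set.Ico_union_Ici_eq_Ici hab]
  rintro x ⟨-, hx⟩ y hy
  exact lt_of_lt_of_le hx hy

/-- In `w`, the `k`-type of every factor is realised arbitrarily far to the right. -/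
def RightRecurrent (k : ℕ) (w : ℤ → σ) : Prop :=
  ∀ i j, i ≤ j → ∀ n, ∃ i' j', n ≤ i' ∧ i' ≤ j' ∧
    tp k w (Set.Ico i' j') = tp k w (Set.Ico i j)

/-- The type of a right tail of a recurrent word is determined by the type of a prefix of it. -/
theorem RightRecurrent.exists_prefix [Finite σ] {k : ℕ} {w : ℤ → σ} (hw : RightRecurrent k w)
    (c : ℤ) : ∃ d, c ≤ d ∧ ∀ c' d', c' ≤ d' → tp k w (Set.Ico c' d') = tp k w (Set.Ico c d) →
      tp k w (Set.Ici c') = tp k w (Set.Ici c) := by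
  obtain ⟨e, f, hf⟩ := exists_homogeneous fun i j : ℕ => tp k w (Set.Ico (c + i) (c + j))
  have hmono : StrictMono f := fun m n hmn => (hf m n hmn).1
  have hblock : ∀ m n, m < n → tp k w (Set.Ico (c + f m) (c + f n)) = e := fun m n hmn =>
    (hf m n hmn).2
  have hle : ∀ m n, m ≤ n → c + f m ≤ c + (f n : ℤ) := fun m n hmn => by
    have := hmono.monotone hmn
    omega
  have hlarge : ∀ z : ℤ, ∃ m, z ≤ c + f (m + 1) := fun z => ⟨(z - c).toNat, by
    have := hmono.le_apply (x := (z - c).toNat + 1)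
    omega⟩
  have he : e * e = e := by
    conv_rhs => rw [← hblock 0 2 (by omega), ← tp_Ico_mul k w (hle 0 1 (by omega))
      (hle 1 2 (by omega)), hblock 0 1 (by omega), hblock 1 2 (by omega)]
  have hdvd : ∀ i j, i ≤ j → ∃ p q, e = p * tp k w (Set.Ico i j) * q := by
    intro i j hij
    obtain ⟨i', j', hi', hij', h⟩ := hw i j hij (c + f 0)
    obtain ⟨m, hm⟩ := hlarge j'
    refine ⟨tp k w (Set.Ico (c + f 0) i'), tp k w (Set.Ico j' (c + f (m + 1))), ?_⟩
    rw [← h, tp_Ico_mul k w hi' hij', tp_Ico_mul k w (hi'.trans hij') hm,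
      hblock 0 (m + 1) (by omega)]
  have htail : ∀ m, tp k w (Set.Ici (c + f m)) = omega fun _ => e := by
    intro m
    have hunion : Set.Ici (c + (f m : ℤ)) =
        ⋃ i : ℕ, Set.Ico (c + f (m + i)) (c + (f (m + (i + 1)) : ℤ)) := by
      ext z
      simp only [Set.mem_Ici, Set.mem_iUnion, Set.mem_Ico]
      constructor
      · intro hz
        by_contra! hcon
        have hall : ∀ i : ℕ, c + (f (m + i) : ℤ) ≤ z := by
          intro i
          induction i with
          | zero => exact hz
          | succ i ih => exact hcon i ih
        obtain ⟨i, hi⟩ := hlarge (z + 1)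
        have := hall (i + 1)
        have := hle (i + 1) (m + (i + 1)) (by omega)
        omega
      · rintro ⟨i, hi, -⟩
        exact (hle m (m + i) (by omega)).trans hi
    rw [hunion, tp_iUnion]
    · exact congrArg omega (funext fun i => hblock _ _ (by omega))
    · rintro i j hij x ⟨-, hx⟩ y ⟨hy, -⟩
      have := hle (m + (i + 1)) (m + j) (by omega)
      omega
  have hc : ∀ m, c ≤ c + (f m : ℤ) := fun m => by omega
  refine ⟨c + f 1, hc 1, fun c' d' hcd' h => ?_⟩
  obtain ⟨m, hm⟩ := hlarge d'
  have hue : tp k w (Set.Ico c (c + f 1)) * e = tp k w (Set.Ico c (c + f 1)) := by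
    conv_lhs => rw [← tp_Ico_mul k w (hc 0) (hle 0 1 (by omega)), hblock 0 1 (by omega),
      mul_assoc, he, ← hblock 0 1 (by omega), tp_Ico_mul k w (hc 0) (hle 0 1 (by omega))]
  have hsplit : tp k w (Set.Ico c (c + f 1)) * tp k w (Set.Ico d' (c + f (m + 1))) * e =
      tp k w (Set.Ico c' (c + f (m + 2))) := by
    rw [← h, tp_Ico_mul k w hcd' hm, ← hblock (m + 1) (m + 2) (by omega),
      tp_Ico_mul k w (hcd'.trans hm) (hle _ _ (by omega))]
  have hc' : c' ≤ c + f (m + 2) := (hcd'.trans hm).trans (hle _ _ (by omega))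
  obtain ⟨g, hg, hge, n, hn⟩ := exists_group_element he hue (hdvd _ _ (hc 1))
    (hsplit ▸ hdvd _ _ hc')
  have hgω : g * omega (fun _ => e) = omega fun _ => e := by
    calc g * omega (fun _ => e) = g * omega (fun _ => g ^ n * g) := by rw [← hn, pow_succ]
      _ = omega (fun _ => g * g ^ n) := (omega_const_mul g (g ^ n)).symm
      _ = omega fun _ => e := by rw [← pow_succ', hn]
  rw [← tp_Ico_mul_Ici k w hc', ← tp_Ico_mul_Ici k w (hc 1), htail, htail, ← hsplit, hg,
    mul_assoc, hgω]

/-- The left-right mirror image of a word; it exchanges `[a, b)` and `[-b, -a)`. -/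
def mirror (w : ℤ → σ) : ℤ → σ := w ∘ fun x => -1 - x

theorem tp_eq_rev_mirror (k : ℕ) (w : ℤ → σ) (D : Set ℤ) :
    tp k w D = rev (tp k (mirror w) ((fun x => -1 - x) ⁻¹' D)) :=
  tp_rev (fun x => -1 - x) (fun x y h => by simpa using h) (fun x => by simp) k w D

theorem mirror_preimage_Ico (a b : ℤ) :
    (fun x : ℤ => -1 - x) ⁻¹' Set.Ico a b = Set.Ico (-b) (-a) := by
  ext x
  simp only [Set.mem_preimage, Set.mem_Ico]
  omega

theorem mirror_preimage_Iio (a : ℤ) : (fun x : ℤ => -1 - x) ⁻¹' Set.Iio a = Set.Ici (-a) := by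
  ext x
  simp only [Set.mem_preimage, Set.mem_Iio, Set.mem_Ici]
  omega

theorem tp_mirror_Ico (k : ℕ) (w : ℤ → σ) (a b : ℤ) :
    tp k (mirror w) (Set.Ico a b) = rev (tp k w (Set.Ico (-b) (-a))) := by
  rw [tp_eq_rev_mirror, mirror_preimage_Ico]
  congr 2
  funext x
  simp [mirror]

/-- The type of a left tail of a recurrent word is determined by the type of a suffix of it. -/
theorem RightRecurrent.exists_suffix [Finite σ] {k : ℕ} {w : ℤ → σ}
    (hw : RightRecurrent k (mirror w)) (c : ℤ) :
    ∃ b, b ≤ c ∧ ∀ b' c', b' ≤ c' → tp k w (Set.Ico b' c') = tp k w (Set.Ico b c) →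
      tp k w (Set.Iio c') = tp k w (Set.Iio c) := by
  obtain ⟨d, hd, h⟩ := hw.exists_prefix (-c)
  refine ⟨-d, by omega, fun b' c' hbc heq => ?_⟩
  rw [tp_eq_rev_mirror k w, mirror_preimage_Iio, tp_eq_rev_mirror k w (Set.Iio c),
    mirror_preimage_Iio]
  refine congrArg rev (h (-c') (-b') (by omega) ?_)
  rw [tp_mirror_Ico, tp_mirror_Ico, neg_neg, neg_neg, neg_neg, heq]

/-! ### Words and types -/

theorem ofList_eq_tp (k : ℕ) {w : ℤ → σ} {u : List σ} {i : ℤ} (h : OccursAt w u i) :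
    ofList k u = tp k w (Set.Ico i (i + u.length)) := by
  induction u generalizing i with
  | nil => simp [ofList, tp_empty]
  | cons x u ih =>
    have h0 : w i = x := by simpa using h ⟨0, by simp⟩
    have hu : OccursAt w u (i + 1) := fun m => by
      have := h m.succ
      simp only [List.length_cons, Fin.val_succ, List.get_eq_getElem] at this ⊢
      rw [show i + 1 + ((m : ℕ) : ℤ) = i + ((m : ℕ) + 1 : ℕ) by push_cast; ring, this]
      simp
    have hstep : tp k w (Set.Ico i (i + 1)) = letter k x := by
      rw [← h0, ← tp_singleton]
      congr 1
      ext z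
      simp only [Set.mem_Ico, Set.mem_singleton_iff]
      omega
    have hlen : i + ((x :: u).length : ℤ) = i + 1 + u.length := by
      rw [List.length_cons]; push_cast; ring
    rw [hlen, ← tp_Ico_mul k w (b := i + 1) (by omega) (by omega), hstep, ← ih hu]
    simp [ofList]

theorem exists_occursAt (w : ℤ → σ) {i j : ℤ} (hij : i ≤ j) :
    ∃ u : List σ, (u.length : ℤ) = j - i ∧ OccursAt w u i :=
  ⟨List.ofFn fun m : Fin (j - i).toNat => w (i + (m : ℕ)), by simp; omega, fun m => by simp⟩

theorem OccursAt.of_append {w : ℤ → σ} {u v : List σ} {i : ℤ} (h : OccursAt w (u ++ v) i) :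
    OccursAt w u i ∧ OccursAt w v (i + u.length) := by
  constructor
  · intro m
    have := h ⟨m, by have := m.2; simp; omega⟩
    simpa using this
  · intro m
    have := h ⟨u.length + m, by simp⟩
    simpa [add_assoc] using this

theorem OccursAt.append {w : ℤ → σ} {u v : List σ} {i : ℤ} (h : OccursAt w u i)
    (h' : OccursAt w v (i + u.length)) : OccursAt w (u ++ v) i := by
  intro m
  by_cases hm : (m : ℕ) < u.length
  · simpa [List.getElem_append_left hm] using h ⟨m, hm⟩
  · have hlt : (m : ℕ) - u.length < v.length := by
      have := m.2
      simp only [List.length_append] at this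
      omega
    have := h' ⟨(m : ℕ) - u.length, hlt⟩
    rw [show i + (u.length : ℤ) + (((m : ℕ) - u.length : ℕ) : ℤ) = i + (m : ℕ) by omega] at this
    simpa [List.getElem_append_right (not_lt.1 hm)] using this

/-- The words that split into factors of two prescribed types. -/
def splitLanguage {k : ℕ} (s t : MType k σ) : Language σ :=
  {z | ∃ x y, z = x ++ y ∧ ofList k x = s ∧ ofList k y = t}

theorem isRegular_splitLanguage [Finite σ] {k : ℕ} (s t : MType k σ) :
    (splitLanguage s t).IsRegular := by
  refine Language.IsRegular.of_finite_range_leftQuotient ?_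
  -- The left quotient by `z` depends only on the type of `z` and the types of its suffixes
  -- that remain after removing a prefix of type `s`.
  let F : MType k σ × Set (MType k σ) → Language σ := fun q =>
    {y | (∃ r ∈ q.2, r * ofList k y = t) ∨
      ∃ y₁ y₂, y = y₁ ++ y₂ ∧ q.1 * ofList k y₁ = s ∧ ofList k y₂ = t}
  refine (Set.finite_range F).subset ?_
  rintro _ ⟨z, rfl⟩
  refine ⟨(ofList k z, {r | ∃ z₁ z₂, z = z₁ ++ z₂ ∧ ofList k z₁ = s ∧ ofList k z₂ = r}), ?_⟩
  refine Set.ext fun y => ?_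
  constructor
  · rintro (⟨_, ⟨z₁, z₂, rfl, h₁, rfl⟩, h₂⟩ | ⟨y₁, y₂, rfl, h₁, h₂⟩)
    · exact ⟨z₁, z₂ ++ y, by simp, h₁, by rw [ofList_append, h₂]⟩
    · exact ⟨z ++ y₁, y₂, by simp, by rw [ofList_append, h₁], h₂⟩
  · rintro ⟨a, b, hab, h₁, h₂⟩
    rcases List.append_eq_append_iff.1 hab with ⟨y₁, rfl, rfl⟩ | ⟨z₂, rfl, rfl⟩
    · exact Or.inr ⟨y₁, b, rfl, by rw [← ofList_append, h₁], h₂⟩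
    · exact Or.inl ⟨_, ⟨a, z₂, rfl, h₁, rfl⟩, by rw [← ofList_append, h₂]⟩

/-- In a recurrent word, the types of two adjacent factors are realised by adjacent factors
arbitrarily far to the left and to the right. -/
theorem Recurrent.exists_split [Finite σ] {w : ℤ → σ} (hw : Recurrent w) (k : ℕ) {a b c : ℤ}
    (hab : a ≤ b) (hbc : b ≤ c) (n : ℤ) :
    (∃ a' b' c', a' ≤ b' ∧ b' ≤ c' ∧ c' ≤ n ∧ tp k w (Set.Ico a' b') = tp k w (Set.Ico a b) ∧
      tp k w (Set.Ico b' c') = tp k w (Set.Ico b c)) ∧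
    (∃ a' b' c', n ≤ a' ∧ a' ≤ b' ∧ b' ≤ c' ∧ tp k w (Set.Ico a' b') = tp k w (Set.Ico a b) ∧
      tp k w (Set.Ico b' c') = tp k w (Set.Ico b c)) := by
  obtain ⟨u, hul, hu⟩ := exists_occursAt w hab
  obtain ⟨v, hvl, hv⟩ := exists_occursAt w hbc
  have hau : a + u.length = b := by omega
  have hbv : b + v.length = c := by omega
  have htu := ofList_eq_tp k hu
  have htv := ofList_eq_tp k hv
  rw [hau] at htu
  rw [hbv] at htv
  have key : ∀ i x, x ∈ splitLanguage (tp k w (Set.Ico a b)) (tp k w (Set.Ico b c)) →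
      OccursAt w x i → ∃ b', i ≤ b' ∧ b' ≤ i + x.length ∧
        tp k w (Set.Ico i b') = tp k w (Set.Ico a b) ∧
        tp k w (Set.Ico b' (i + x.length)) = tp k w (Set.Ico b c) := by
    rintro i _ ⟨x, y, rfl, hx, hy⟩ hocc
    obtain ⟨ho, ho'⟩ := hocc.of_append
    have hlen : i + ((x ++ y).length : ℤ) = i + x.length + y.length := by
      rw [List.length_append]; push_cast; ring
    refine ⟨i + x.length, by omega, by omega, ?_, ?_⟩
    · rw [← ofList_eq_tp k ho, hx]
    · rw [hlen, ← ofList_eq_tp k ho', hy]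
  rcases hw _ (isRegular_splitLanguage (tp k w (Set.Ico a b)) (tp k w (Set.Ico b c))) with h | h
  · exact absurd ⟨a, hu.append (hau ▸ hv)⟩ (h (u ++ v) ⟨u, v, rfl, htu, htv⟩)
  · obtain ⟨⟨x, hx, i, hi, ho⟩, ⟨y, hy, j, hj, ho'⟩⟩ := h n
    obtain ⟨b', h₁, h₂, h₃, h₄⟩ := key i x hx ho
    obtain ⟨b'', h₁', h₂', h₃', h₄'⟩ := key j y hy ho'
    exact ⟨⟨i, b', _, h₁, h₂, hi, h₃, h₄⟩, ⟨j, b'', _, hj, h₁', h₂', h₃', h₄'⟩⟩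

theorem Recurrent.rightRecurrent [Finite σ] {w : ℤ → σ} (hw : Recurrent w) (k : ℕ) :
    RightRecurrent k w := by
  intro i j hij n
  obtain ⟨-, a, b, c, h₁, h₂, h₃, -, h⟩ := hw.exists_split k le_rfl hij n
  exact ⟨b, c, by omega, h₃, h⟩

theorem Recurrent.rightRecurrent_mirror [Finite σ] {w : ℤ → σ} (hw : Recurrent w) (k : ℕ) :
    RightRecurrent k (mirror w) := by
  intro i j hij n
  obtain ⟨⟨a, b, c, -, h₂, h₃, -, h⟩, -⟩ :=
    hw.exists_split k le_rfl (show -j ≤ -i by omega) (-n)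
  refine ⟨-c, -b, by omega, by omega, ?_⟩
  rw [tp_mirror_Ico, tp_mirror_Ico, neg_neg, neg_neg, h]

/-- In a recurrent word, every position has a different position with the same types of both
tails. -/
theorem Recurrent.exists_same_tails [Finite σ] {w : ℤ → σ} (hw : Recurrent w) (k : ℕ) (c : ℤ) :
    ∃ c', c' ≠ c ∧ tp k w (Set.Iio c') = tp k w (Set.Iio c) ∧
      tp k w (Set.Ici c') = tp k w (Set.Ici c) := by
  obtain ⟨d, hd, hright⟩ := (hw.rightRecurrent k).exists_prefix c
  obtain ⟨b, hb, hleft⟩ := (hw.rightRecurrent_mirror k).exists_suffix c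
  obtain ⟨-, b', c', d', h₁, h₂, h₃, h₄, h₅⟩ := hw.exists_split k hb hd (c + 1)
  exact ⟨c', by omega, hleft b' c' h₂ h₄, hright c' d' h₃ h₅⟩

end Recurrence

/-! ## Types determine satisfaction -/

section Sat

variable {n : ℕ}

theorem MSO.sat_congr {A : Type} (r : A → A → Prop) (P : Fin n → Set A) (φ : MSO n) :
    ∀ {v v' : ℕ → A} {V V' : ℕ → Set A}, (∀ i ∈ fv1 φ, v i = v' i) → (∀ j ∈ fv2 φ, V j = V' j) →
      (Sat r P v V φ ↔ Sat r P v' V' φ) := by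
  induction φ with
  | lt i j =>
    intro v v' V V' h _
    simp only [Sat]
    rw [h i (by simp [fv1]), h j (by simp [fv1])]
  | pred p i =>
    intro v v' V V' h _
    simp only [Sat]
    rw [h i (by simp [fv1])]
  | mem i j =>
    intro v v' V V' h h'
    simp only [Sat]
    rw [h i (by simp [fv1]), h' j (by simp [fv2])]
  | not φ ih =>
    intro v v' V V' h h'
    exact not_congr (ih h h')
  | and φ ψ ih ih' =>
    intro v v' V V' h h'
    exact and_congr
      (ih (fun i hi => h i (Finset.mem_union_left _ hi))
        (fun j hj => h' j (Finset.mem_union_left _ hj)))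
      (ih' (fun i hi => h i (Finset.mem_union_right _ hi))
        (fun j hj => h' j (Finset.mem_union_right _ hj)))
  | ex1 i φ ih =>
    intro v v' V V' h h'
    refine exists_congr fun x => ih (fun m hm => ?_) h'
    by_cases hmi : m = i
    · subst hmi; simp
    · simpa [hmi] using h m (by simp [fv1, hm, hmi])
  | ex2 j φ ih =>
    intro v v' V V' h h'
    refine exists_congr fun x => ih h (fun m hm => ?_)
    by_cases hmj : m = j
    · subst hmj; simp
    · simpa [hmj] using h' m (by simp [fv2, hm, hmj])

/-- The assignments `v`, `V` and the predicates `P` can be read off the labelling `a`. -/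
structure Decodes {σ : Type} (P : Fin n → Set ℤ) (a : ℤ → σ) (v : ℕ → ℤ) (V : ℕ → Set ℤ)
    (C : ℕ → Set σ) (D : ℕ → Set σ) (E : Fin n → Set σ) : Prop where
  fst : ∀ i x, a x ∈ C i ↔ x = v i
  snd : ∀ j x, a x ∈ D j ↔ x ∈ V j
  pred : ∀ p x, a x ∈ E p ↔ x ∈ P p

theorem Decodes.update_fst {σ : Type} {P : Fin n → Set ℤ} {a : ℤ → σ} {v : ℕ → ℤ}
    {V : ℕ → Set ℤ} {C D : ℕ → Set σ} {E : Fin n → Set σ} (h : Decodes P a v V C D E) (i : ℕ)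
    {b : ℤ → Prop} {y : ℤ} (hb : ∀ x, b x ↔ x = y) :
    Decodes P (fun x => (a x, b x)) (Function.update v i y) V
      (Function.update (fun m => Prod.fst ⁻¹' C m) i {s | s.2})
      (fun m => Prod.fst ⁻¹' D m) (fun m => Prod.fst ⁻¹' E m) where
  fst m x := by
    by_cases hm : m = i
    · subst hm; simpa using hb x
    · simpa [hm] using h.fst m x
  snd := h.snd
  pred := h.pred

theorem Decodes.update_snd {σ : Type} {P : Fin n → Set ℤ} {a : ℤ → σ} {v : ℕ → ℤ}
    {V : ℕ → Set ℤ} {C D : ℕ → Set σ} {E : Fin n → Set σ} (h : Decodes P a v V C D E) (j : ℕ)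
    (b : ℤ → Prop) :
    Decodes P (fun x => (a x, b x)) v (Function.update V j {x | b x})
      (fun m => Prod.fst ⁻¹' C m) (Function.update (fun m => Prod.fst ⁻¹' D m) j {s | s.2})
      (fun m => Prod.fst ⁻¹' E m) where
  fst := h.fst
  snd m x := by
    by_cases hm : m = j
    · subst hm; simp
    · simpa [hm] using h.snd m x
  pred := h.pred

theorem MSO.sat_of_tp_eq (P : Fin n → Set ℤ) (φ : MSO n) :
    ∀ {k : ℕ} {σ : Type} {a b : ℤ → σ} {v v' : ℕ → ℤ} {V V' : ℕ → Set ℤ} {C D : ℕ → Set σ}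
      {E : Fin n → Set σ}, tp k a Set.univ = tp k b Set.univ → qd φ ≤ k →
      Decodes P a v V C D E → Decodes P b v' V' C D E →
      Sat (fun x y : ℤ => x < y) P v V φ → Sat (fun x y : ℤ => x < y) P v' V' φ := by
  induction φ with
  | lt i j =>
    intro k σ a b v v' V V' C D E htp _ ha hb h
    obtain ⟨x, -, y, -, hxy, hx, hy⟩ := tp_pair htp _ trivial _ trivial h
    have hx' : x = v' i := by rw [← hb.fst, hx, ha.fst]
    have hy' : y = v' j := by rw [← hb.fst, hy, ha.fst]
    rwa [hx', hy'] at hxy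
  | pred p i =>
    intro k σ a b v v' V V' C D E htp _ ha hb h
    obtain ⟨x, -, hx⟩ := tp_letter htp (v i) trivial
    have hx' : x = v' i := by rw [← hb.fst, hx, ha.fst]
    change v' i ∈ P p
    rw [← hx', ← hb.pred, hx, ha.pred]
    exact h
  | mem i j =>
    intro k σ a b v v' V V' C D E htp _ ha hb h
    obtain ⟨x, -, hx⟩ := tp_letter htp (v i) trivial
    have hx' : x = v' i := by rw [← hb.fst, hx, ha.fst]
    change v' i ∈ V' j
    rw [← hx', ← hb.snd, hx, ha.snd]
    exact h
  | not φ ih =>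
    intro k σ a b v v' V V' C D E htp hk ha hb h h'
    exact h (ih htp.symm hk hb ha h')
  | and φ ψ ih ih' =>
    intro k σ a b v v' V V' C D E htp hk ha hb h
    exact ⟨ih htp (le_trans (le_max_left _ _) hk) ha hb h.1,
      ih' htp (le_trans (le_max_right _ _) hk) ha hb h.2⟩
  | ex1 i φ ih =>
    intro k σ a b v v' V V' C D E htp hk ha hb ⟨x, hx⟩
    obtain ⟨k, rfl⟩ : ∃ k', k = k' + 1 := ⟨k - 1, by simp only [qd] at hk; omega⟩
    obtain ⟨c, hc⟩ := tp_succ_exists htp (fun z => z = x)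
    obtain ⟨y, -, hy⟩ := tp_letter hc x trivial
    have hcy : c y := by simpa using congrArg Prod.snd hy
    have hlt : ∀ z z', c z → c z' → ¬ z < z' := by
      intro z z' hz hz' hzz
      obtain ⟨t, -, t', -, htt, h₁, h₂⟩ := tp_pair hc.symm z trivial z' trivial hzz
      have e₁ : t = x := by simpa [hz] using congrArg Prod.snd h₁
      have e₂ : t' = x := by simpa [hz'] using congrArg Prod.snd h₂
      omega
    have huniq : ∀ z, c z ↔ z = y := fun z =>
      ⟨fun hz => le_antisymm (not_lt.1 (hlt y z hcy hz)) (not_lt.1 (hlt z y hz hcy)),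
        fun hz => hz ▸ hcy⟩
    exact ⟨y, ih hc (Nat.le_of_succ_le_succ hk) (ha.update_fst i fun _ => Iff.rfl)
      (hb.update_fst i huniq) hx⟩
  | ex2 j φ ih =>
    intro k σ a b v v' V V' C D E htp hk ha hb ⟨S, hS⟩
    obtain ⟨k, rfl⟩ : ∃ k', k = k' + 1 := ⟨k - 1, by simp only [qd] at hk; omega⟩
    obtain ⟨c, hc⟩ := tp_succ_exists htp (fun z => z ∈ S)
    exact ⟨{z | c z}, ih hc (Nat.le_of_succ_le_succ hk) (ha.update_snd j _)
      (hb.update_snd j _) hS⟩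

/-- Two positions with the same types of both tails have the same pointed type. -/
theorem tp_pointed_eq {k : ℕ} {σ : Type} {w : ℤ → σ} {c c' : ℤ}
    (hl : tp (k + 1) w (Set.Iio c) = tp (k + 1) w (Set.Iio c'))
    (hr : tp (k + 1) w (Set.Ici c) = tp (k + 1) w (Set.Ici c')) :
    tp k (fun x => (w x, x = c)) Set.univ = tp k (fun x => (w x, x = c')) Set.univ := by
  have hsplit : ∀ d : ℤ, tp k (fun x => (w x, x = d)) Set.univ =
      tp k (fun x => (w x, x = d)) (Set.Iio d) * tp k (fun x => (w x, x = d)) (Set.Ici d) := by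
    intro d
    rw [← tp_union, Set.Iio_union_Ici]
    exact fun x hx y hy => lt_of_lt_of_le hx hy
  rw [hsplit c, hsplit c']
  congr 1
  · obtain ⟨b, hb⟩ := tp_succ_exists hl (fun x => x = c)
    rw [hb]
    refine tp_congr k fun x hx => Prod.ext rfl (propext ⟨fun hbx => ?_, fun h => ?_⟩)
    · obtain ⟨y, hy, hyx⟩ := tp_letter hb.symm x hx
      change b x at hbx
      have : y = c := by simpa [hbx] using congrArg Prod.snd hyx
      exact absurd hy (by simp [this])
    · change x = c' at h
      exact absurd hx (by simp [h])
  · obtain ⟨b, hb⟩ := tp_succ_exists hr (fun x => x = c)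
    rw [hb]
    have hpos : ∀ y ∈ Set.Ici c', b y → ¬ c' < y := by
      intro y hy hby hlt
      obtain ⟨t, ht, t', -, htt, -, h₂⟩ :=
        tp_pair hb.symm c' (Set.mem_Ici.2 le_rfl) y hy hlt
      have e₂ : t' = c := by simpa [hby] using congrArg Prod.snd h₂
      have := Set.mem_Ici.1 ht
      omega
    obtain ⟨y, hy, hyc⟩ := tp_letter hb c (Set.mem_Ici.2 le_rfl)
    have hby : b y := by simpa using congrArg Prod.snd hyc
    have hyc' : y = c' := le_antisymm (not_lt.1 (hpos y hy hby)) hy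
    refine tp_congr k fun x hx => Prod.ext rfl (propext ⟨fun hbx => ?_, fun h => ?_⟩)
    · exact le_antisymm (not_lt.1 (hpos x hx hbx)) hx
    · change x = c' at h
      rwa [h, ← hyc']

theorem not_definable_of_recurrent {P : Fin n → Set ℤ} (hP : Recurrent (wordOf P)) (c : ℤ) :
    ¬ MSO.Definable (fun x y : ℤ => x < y) P {c} := by
  rintro ⟨φ, h₁, h₂, hφ⟩
  obtain ⟨c', hne, hl, hr⟩ := hP.exists_same_tails (MSO.qd φ + 1) c
  have hdec : ∀ d : ℤ, Decodes P (fun x => (wordOf P x, x = d)) (fun _ => d) (fun _ => ∅)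
      (fun _ => {s | s.2}) (fun _ => ∅) (fun p => {s | s.1 p}) := fun d =>
    ⟨fun _ _ => Iff.rfl, fun _ _ => Iff.rfl, fun _ _ => Iff.rfl⟩
  have hc := (hφ c).1 rfl (fun _ => c) (fun _ => ∅)
  rw [Function.update_eq_self] at hc
  have hc' := MSO.sat_of_tp_eq P φ (tp_pointed_eq hl.symm hr.symm) le_rfl (hdec c) (hdec c') hc
  refine hne ((hφ c').2 fun v V => ?_)
  refine (MSO.sat_congr _ P φ (fun i hi => ?_) (fun j hj => ?_)).1 hc'
  · rw [Finset.mem_singleton.1 (h₁ hi), Function.update_self]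
  · simp [h₂] at hj

end Sat

/-! ## Definable relations and non-recurrent words -/

section Definability

variable {n : ℕ} {P : Fin n → Set ℤ}

/-- Every formula can be existentially closed over a finite set of set variables. -/
theorem MSO.exists_ex2 {A : Type} (r : A → A → Prop) (P : Fin n → Set A) (φ : MSO n)
    (s : Finset ℕ) :
    ∃ ψ : MSO n, fv1 ψ = fv1 φ ∧ fv2 ψ = fv2 φ \ s ∧
      ∀ v V, Sat r P v V ψ ↔ ∃ V', (∀ j ∉ s, V' j = V j) ∧ Sat r P v V' φ := by
  induction s using Finset.induction_on with
  | empty =>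
    refine ⟨φ, rfl, by simp, fun v V => ⟨fun h => ⟨V, fun _ _ => rfl, h⟩, ?_⟩⟩
    rintro ⟨V', h, h'⟩
    rwa [← show V' = V from funext fun j => h j (by simp)]
  | insert a s ha ih =>
    obtain ⟨ψ, h₁, h₂, h⟩ := ih
    refine ⟨ex2 a ψ, h₁, by rw [fv2, h₂]; grind, fun v V => ?_⟩
    simp only [Sat, h]
    constructor
    · rintro ⟨S, V', hV, hφ⟩
      refine ⟨V', fun j hj => ?_, hφ⟩
      rw [Finset.mem_insert, not_or] at hj
      rw [hV j hj.2, Function.update_of_ne hj.1]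
    · rintro ⟨V', hV, hφ⟩
      refine ⟨V' a, V', fun j hj => ?_, hφ⟩
      by_cases hja : j = a
      · simp [hja]
      · rw [Function.update_of_ne hja, hV j (by simp [hja, hj])]

/-- Every formula can be existentially closed over a finite set of first-order variables. -/
theorem MSO.exists_ex1 {A : Type} (r : A → A → Prop) (P : Fin n → Set A) (φ : MSO n)
    (s : Finset ℕ) :
    ∃ ψ : MSO n, fv1 ψ = fv1 φ \ s ∧ fv2 ψ = fv2 φ ∧
      ∀ v V, Sat r P v V ψ ↔ ∃ v', (∀ i ∉ s, v' i = v i) ∧ Sat r P v' V φ := by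
  induction s using Finset.induction_on with
  | empty =>
    refine ⟨φ, by simp, rfl, fun v V => ⟨fun h => ⟨v, fun _ _ => rfl, h⟩, ?_⟩⟩
    rintro ⟨v', h, h'⟩
    rwa [← show v' = v from funext fun j => h j (by simp)]
  | insert a s ha ih =>
    obtain ⟨ψ, h₁, h₂, h⟩ := ih
    refine ⟨ex1 a ψ, by rw [fv1, h₁]; grind, h₂, fun v V => ?_⟩
    simp only [Sat, h]
    constructor
    · rintro ⟨S, v', hv, hφ⟩
      refine ⟨v', fun j hj => ?_, hφ⟩
      rw [Finset.mem_insert, not_or] at hj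
      rw [hv j hj.2, Function.update_of_ne hj.1]
    · rintro ⟨v', hv, hφ⟩
      refine ⟨v' a, v', fun j hj => ?_, hφ⟩
      by_cases hja : j = a
      · simp [hja]
      · rw [Function.update_of_ne hja, hv j (by simp [hja, hj])]

/-- A property of assignments is expressible by an MSO formula in `(ℤ, <, P)`. -/
def Expressible (P : Fin n → Set ℤ) (R : (ℕ → ℤ) → (ℕ → Set ℤ) → Prop) : Prop :=
  ∃ φ : MSO n, ∀ v V, MSO.Sat (fun x y : ℤ => x < y) P v V φ ↔ R v V

namespace Expressible

variable {R R' : (ℕ → ℤ) → (ℕ → Set ℤ) → Prop}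

theorem congr (h : Expressible P R) (hR : ∀ v V, R v V ↔ R' v V) : Expressible P R' := by
  obtain ⟨φ, hφ⟩ := h
  exact ⟨φ, fun v V => (hφ v V).trans (hR v V)⟩

theorem lt (i j : ℕ) : Expressible P fun v _ => v i < v j := ⟨.lt i j, fun _ _ => Iff.rfl⟩

theorem pred (k : Fin n) (i : ℕ) : Expressible P fun v _ => v i ∈ P k :=
  ⟨.pred k i, fun _ _ => Iff.rfl⟩

theorem mem (i j : ℕ) : Expressible P fun v V => v i ∈ V j := ⟨.mem i j, fun _ _ => Iff.rfl⟩

theorem not (h : Expressible P R) : Expressible P fun v V => ¬ R v V := by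
  obtain ⟨φ, hφ⟩ := h
  exact ⟨.not φ, fun v V => not_congr (hφ v V)⟩

theorem and (h : Expressible P R) (h' : Expressible P R') :
    Expressible P fun v V => R v V ∧ R' v V := by
  obtain ⟨φ, hφ⟩ := h
  obtain ⟨ψ, hψ⟩ := h'
  exact ⟨.and φ ψ, fun v V => and_congr (hφ v V) (hψ v V)⟩

theorem imp (h : Expressible P R) (h' : Expressible P R') :
    Expressible P fun v V => R v V → R' v V :=
  (h.and h'.not).not.congr fun _ _ => by tauto

theorem ex (i : ℕ) (h : Expressible P R) :
    Expressible P fun v V => ∃ a, R (Function.update v i a) V := by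
  obtain ⟨φ, hφ⟩ := h
  exact ⟨.ex1 i φ, fun v V => exists_congr fun a => hφ _ V⟩

theorem all (i : ℕ) (h : Expressible P R) :
    Expressible P fun v V => ∀ a, R (Function.update v i a) V :=
  (h.not.ex i).not.congr fun _ _ => by simp

theorem exSets (h : Expressible P R) : Expressible P fun v _ => ∃ V, R v V := by
  classical
  obtain ⟨φ, hφ⟩ := h
  obtain ⟨ψ, -, -, hψ⟩ := MSO.exists_ex2 (fun x y : ℤ => x < y) P φ (MSO.fv2 φ)
  refine ⟨ψ, fun v V => (hψ v V).trans ⟨fun ⟨V', _, h⟩ => ⟨V', (hφ v V').1 h⟩, ?_⟩⟩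
  rintro ⟨V', h⟩
  refine ⟨fun j => if j ∈ MSO.fv2 φ then V' j else V j, fun j hj => if_neg hj, ?_⟩
  exact (MSO.sat_congr _ P φ (fun _ _ => rfl) fun j hj => (if_pos hj).symm).1 ((hφ v V').2 h)

theorem const (p : Prop) : Expressible P fun _ _ => p := by
  by_cases hp : p
  · exact (lt 0 0).not.congr fun _ _ => by simp [hp]
  · exact (lt 0 0).congr fun _ _ => by simp [hp]

theorem eq (i j : ℕ) : Expressible P fun v _ => v i = v j :=
  ((lt i j).not.and (lt j i).not).congr fun _ _ => by
    rw [not_lt, not_lt, and_comm, le_antisymm_iff]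

theorem forall_finite {ι : Type*} [Finite ι] {R : ι → (ℕ → ℤ) → (ℕ → Set ℤ) → Prop}
    (h : ∀ i, Expressible P (R i)) : Expressible P fun v V => ∀ i, R i v V := by
  classical
  have := Fintype.ofFinite ι
  suffices H : ∀ s : Finset ι, Expressible P fun v V => ∀ i ∈ s, R i v V from
    (H Finset.univ).congr fun _ _ => by simp
  intro s
  induction s using Finset.induction_on with
  | empty => exact (const True).congr fun _ _ => by simp
  | insert a s _ ih => exact ((h a).and ih).congr fun _ _ => by simp

theorem succ : Expressible P fun v _ => v 3 = v 2 + 1 :=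
  ((lt 2 3).and (((lt 2 4).and (lt 4 3)).ex 4).not).congr fun v _ => by
    simp only [Function.update_self, ne_eq, Nat.reduceEqDiff, not_false_eq_true,
      Function.update_of_ne]
    constructor
    · rintro ⟨h, h'⟩
      by_contra hne
      exact h' ⟨v 2 + 1, by omega, by omega⟩
    · intro h
      exact ⟨by omega, fun ⟨a, h₁, h₂⟩ => by omega⟩

theorem letter (i : ℕ) (a : Fin n → Prop) : Expressible P fun v _ => wordOf P (v i) = a :=
  (forall_finite fun k : Fin n =>
    ((pred k i).imp (const (a k))).and ((const (a k)).imp (pred k i))).congr fun v _ => by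
      rw [funext_iff]
      exact forall_congr' fun k => ⟨fun h => propext ⟨h.1, h.2⟩, fun h => ⟨h.mp, h.mpr⟩⟩

/-- Membership in a definable set can be tested on any variable. -/
theorem rename {S : Set ℤ} (h : Expressible P fun v _ => v 0 ∈ S) (i : ℕ) :
    Expressible P fun v _ => v i ∈ S := by
  by_cases hi : i = 0
  · rwa [hi]
  · refine (((eq 0 i).and h).ex 0).congr fun v _ => ?_
    simp [Function.update_of_ne hi]

theorem definable {S : Set ℤ} (h : Expressible P fun v _ => v 0 ∈ S) :
    MSO.Definable (fun x y : ℤ => x < y) P S := by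
  obtain ⟨φ, hφ⟩ := h
  obtain ⟨ψ, h₁, h₂, hψ⟩ := MSO.exists_ex2 (fun x y : ℤ => x < y) P φ (MSO.fv2 φ)
  obtain ⟨χ, h₃, h₄, hχ⟩ := MSO.exists_ex1 (fun x y : ℤ => x < y) P ψ (MSO.fv1 ψ \ {0})
  refine ⟨χ, by rw [h₃]; grind, by rw [h₄, h₂, Finset.sdiff_self], fun a => ?_⟩
  have hsat : ∀ v V, MSO.Sat (fun x y : ℤ => x < y) P v V χ ↔ v 0 ∈ S := by
    intro v V
    rw [hχ]
    constructor
    · rintro ⟨v', hv, hs⟩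
      obtain ⟨V', -, hs⟩ := (hψ _ _).1 hs
      rw [← hv 0 (by simp)]
      exact (hφ _ _).1 hs
    · exact fun hv => ⟨v, fun _ _ => rfl, (hψ _ _).2 ⟨V, fun _ _ => rfl, (hφ _ _).2 hv⟩⟩
  simp [hsat]

end Expressible

/-- A word of a given regular language occurs exactly between the positions `v 0` and `v 1`. -/
theorem expressible_occurrence {X : Language (Fin n → Prop)} (hX : X.IsRegular) :
    Expressible P fun v _ => ∃ u ∈ X, OccursAt (wordOf P) u (v 0) ∧ v 1 = v 0 + u.length := by
  obtain ⟨Q, _, M, rfl⟩ := hX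
  let e := Fintype.equivFin Q
  have hclosed : Expressible P fun v V => ∀ a b, b = a + 1 → ∀ (s : Q) (α : Fin n → Prop),
      wordOf P a = α → a ∈ V (e s) → b ∈ V (e (M.step s α)) := by
    refine (((Expressible.succ.imp (.forall_finite fun s : Q => .forall_finite
      fun α : Fin n → Prop => (Expressible.letter 2 α).imp
        ((Expressible.mem 2 (e s)).imp (.mem 3 (e (M.step s α)))))).all 3).all 2).congr
      fun v V => ?_
    simp
  have hreject : Expressible P fun v V => ∀ s : Q, s ∈ M.accept → ¬ v 1 ∈ V (e s) :=
    .forall_finite fun s => (Expressible.const _).imp (Expressible.mem 1 _).not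
  refine (((Expressible.mem 0 (e M.start)).and (hclosed.and hreject)).exSets).not.congr
    fun v _ => ⟨fun h => ?_, ?_⟩
  · by_contra hno
    refine h ⟨fun j => {z | ∃ u, OccursAt (wordOf P) u (v 0) ∧ z = v 0 + u.length ∧
      (e (M.eval u) : ℕ) = j}, ⟨[], fun k => k.elim0, by simp, rfl⟩, ?_, ?_⟩
    · rintro a b rfl s α hα ⟨u, hu, rfl, hs⟩
      refine ⟨u ++ [α], hu.append ?_, by simp [add_assoc], ?_⟩
      · intro k
        simpa [Fin.fin_one_eq_zero k] using hα
      · rw [DFA.eval_append_singleton, e.injective (Fin.val_injective hs)]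
    · rintro s hs ⟨u, hu, hv, hus⟩
      refine hno ⟨u, ?_, hu, hv⟩
      rw [DFA.mem_accepts, e.injective (Fin.val_injective hus)]
      exact hs
  · rintro ⟨u, hu, hocc, hv⟩ ⟨V, hstart, hstep, hrej⟩
    have hrun : ∀ (u : List (Fin n → Prop)) (x : ℤ) (s : Q), OccursAt (wordOf P) u x →
        x ∈ V (e s) → x + u.length ∈ V (e (M.evalFrom s u)) := by
      intro u
      induction u with
      | nil => simp
      | cons α u ih =>
        intro x s hocc hx
        have h := OccursAt.of_append (u := [α]) (v := u) hocc
        have := ih (x + 1) (M.step s α) (by simpa using h.2)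
          (hstep x _ rfl s α (by simpa using h.1 ⟨0, by simp⟩) hx)
        rw [DFA.evalFrom_cons]
        convert this using 1
        push_cast [List.length_cons]
        ring
    exact hrej _ hu (hv ▸ hrun u _ _ hocc hstart)

theorem expressible_greatest {S : Set ℤ} (h : Expressible P fun v _ => v 0 ∈ S) {m : ℤ}
    (hm : IsGreatest S m) : Expressible P fun v _ => v 0 ∈ ({m} : Set ℤ) := by
  refine (h.and (((h.rename 1).imp (Expressible.lt 0 1).not).all 1)).congr fun v _ => ?_
  simp only [Function.update_self, ne_eq, zero_ne_one, not_false_eq_true, Function.update_of_ne,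
    not_lt, Set.mem_singleton_iff]
  exact ⟨fun H => le_antisymm (hm.2 H.1) (H.2 m hm.1), fun H => H ▸ ⟨hm.1, fun a ha => hm.2 ha⟩⟩

theorem expressible_least {S : Set ℤ} (h : Expressible P fun v _ => v 0 ∈ S) {m : ℤ}
    (hm : IsLeast S m) : Expressible P fun v _ => v 0 ∈ ({m} : Set ℤ) := by
  refine (h.and (((h.rename 1).imp (Expressible.lt 1 0).not).all 1)).congr fun v _ => ?_
  simp only [Function.update_self, ne_eq, zero_ne_one, not_false_eq_true, Function.update_of_ne,
    not_lt, Set.mem_singleton_iff]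
  exact ⟨fun H => le_antisymm (H.2 m hm.1) (hm.2 H.1), fun H => H ▸ ⟨hm.1, fun a ha => hm.2 ha⟩⟩

/-- If one integer is definable, then so are all integers. -/
theorem expressible_singleton {m : ℤ} (h : Expressible P fun v _ => v 0 ∈ ({m} : Set ℤ)) (c : ℤ) :
    Expressible P fun v _ => v 0 ∈ ({c} : Set ℤ) := by
  refine Int.inductionOn' c m h (fun k _ ih => ?_) fun k _ ih => ?_
  · refine expressible_least (S := Set.Ioi k) ?_ ⟨by simp, fun a ha => Set.mem_Ioi.1 ha⟩
    refine (((ih.rename 1).and (.lt 1 0)).ex 1).congr fun v _ => ?_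
    simp
  · refine expressible_greatest (S := Set.Iio k) ?_ ⟨by simp, fun a ha => Int.le_sub_one_of_lt ha⟩
    refine (((ih.rename 1).and (.lt 0 1)).ex 1).congr fun v _ => ?_
    simp

theorem definable_of_not_recurrent (hP : ¬ Recurrent (wordOf P)) (c : ℤ) :
    MSO.Definable (fun x y : ℤ => x < y) P {c} := by
  simp only [Recurrent, not_forall, not_or, not_and_or, not_not] at hP
  obtain ⟨X, hX, ⟨u, hu, i, hi⟩, b, hb⟩ := hP
  have hocc := expressible_occurrence (P := P) hX
  suffices ∃ m : ℤ, Expressible P fun v _ => v 0 ∈ ({m} : Set ℤ) by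
    obtain ⟨m, hm⟩ := this
    exact (expressible_singleton hm c).definable
  rcases hb with hb | hb
  · let S : Set ℤ := {y | ∃ u ∈ X, ∃ x, OccursAt (wordOf P) u x ∧ y = x + u.length}
    have hS : Expressible P fun v _ => v 0 ∈ S := by
      refine (((Expressible.eq 1 2).and hocc).ex 0 |>.ex 1 |>.and (.eq 0 2) |>.ex 2).congr
        fun v _ => ?_
      simp only [Function.update_self, ne_eq, OfNat.zero_ne_ofNat, one_ne_zero, not_false_eq_true, Function.update_of_ne]
      constructor
      · rintro ⟨_, ⟨_, x, rfl, u, hu, hx, he⟩, h⟩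
        exact ⟨u, hu, x, hx, h.trans he⟩
      · rintro ⟨u, hu, x, hx, he⟩
        exact ⟨v 0, ⟨v 0, x, rfl, u, hu, hx, he⟩, rfl⟩
    obtain ⟨m, hm, hle⟩ := Int.exists_least_of_bdd (P := (· ∈ S))
      ⟨b, fun z ⟨u, hu, x, hx, he⟩ => by
        by_contra hz
        exact hb ⟨u, hu, x, by omega, hx⟩⟩ ⟨_, u, hu, i, hi, rfl⟩
    exact ⟨m, expressible_least hS ⟨hm, fun a ha => hle a ha⟩⟩
  · let S : Set ℤ := {x | ∃ u ∈ X, OccursAt (wordOf P) u x}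
    have hS : Expressible P fun v _ => v 0 ∈ S := by
      refine (hocc.ex 1).congr fun v _ => ?_
      simp only [Function.update_self, ne_eq, zero_ne_one, not_false_eq_true,
        Function.update_of_ne]
      exact ⟨fun ⟨_, u, hu, hx, _⟩ => ⟨u, hu, hx⟩, fun ⟨u, hu, hx⟩ => ⟨_, u, hu, hx, rfl⟩⟩
    obtain ⟨m, hm, hle⟩ := Int.exists_greatest_of_bdd (P := (· ∈ S))
      ⟨b, fun z ⟨u, hu, hx⟩ => by
        by_contra hz
        exact hb ⟨u, hu, z, by omega, hx⟩⟩ ⟨i, u, hu, hi⟩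
    exact ⟨m, expressible_greatest hS ⟨hm, fun a ha => hle a ha⟩⟩

end Definability

end Paper

open Paper

/-- Let `M = (ℤ, <, P₁, …, Pₙ)`.  If `M` is not recurrent then every element
`c ∈ ℤ` is MSO-definable in `M`; if `M` is recurrent then no element of `ℤ` is
MSO-definable in `M`. -/
theorem stmt_16 {n : ℕ} (P : Fin n → Set ℤ) :
    (¬ Recurrent (wordOf P) →
      ∀ c : ℤ, MSO.Definable (fun x y : ℤ => x < y) P {c}) ∧
    (Recurrent (wordOf P) →
      ∀ c : ℤ, ¬ MSO.Definable (fun x y : ℤ => x < y) P {c}) := by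
  exact ⟨fun h c => definable_of_not_recurrent h c, fun h c => not_definable_of_recurrent h c⟩
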